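/- (Mapping theorem, classical field equations.) Let g > 0 and let φ : ℝ → ℝ be twice continuously differentiable with φ''(t) + 2g² φ(t)³ = 0 for all t. Define the SU(2) gauge field A^a_μ : ℝ⁴ → ℝ by the Smilga choice A^a_μ(x) = δ^a_μ φ(x₀) for a ∈ {1,2,3}, μ ∈ {0,1,2,3} (so A^a_0 = 0, A^a_i = δ^a_i φ(x₀)), and let F^a_{μν} = ∂_μ A^a_ν − ∂_ν A^a_μ + g ε_{abc} A^b_μ A^c_ν be the field strength. Then A satisfies the classical SU(2) Yang-Mills equations: ∂^μ F^a_{μν} + g ε_{abc} A^{bμ} F^c_{μν} = 0 for every a ∈ {1,2,3} and every ν ∈ {0,1,2,3}, indices being raised with the Minkowski metric η = diag(1, −1, −1, −1). Thus every extremum of the quartic scalar action with λ = 2g² yields an extremum of the SU(2) Yang-Mills action. -/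

import Mathlib

/-- The Minkowski metric `η = diag(1, -1, -1, -1)` (diagonal entries). -/
noncomputable def η (μ : Fin 4) : ℝ := if μ = 0 then 1 else -1

/-- The Levi-Civita symbol `ε_{abc}` on indices `{0, 1, 2}` (colour indices). -/
noncomputable def eps (a b c : Fin 3) : ℝ :=
  (((b : ℕ) : ℝ) - ((a : ℕ) : ℝ)) * (((c : ℕ) : ℝ) - ((b : ℕ) : ℝ)) *
    (((c : ℕ) : ℝ) - ((a : ℕ) : ℝ)) / 2

/-- Partial derivative of a function on `ℝ⁴ = Fin 4 → ℝ` in the `μ`-th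
coordinate direction. -/
noncomputable def pdiff (μ : Fin 4) (f : (Fin 4 → ℝ) → ℝ) : (Fin 4 → ℝ) → ℝ :=
  fun x => deriv (fun z : ℝ => f (Function.update x μ z)) (x μ)

/-- The partial derivatives of a function depending on the time coordinate only, present or
absent according to a fixed condition. -/
theorem pdiff_ite_comp_time (p : Prop) [Decidable p] (f : ℝ → ℝ) (μ : Fin 4) (x : Fin 4 → ℝ) :
    pdiff μ (fun y => if p then f (y 0) else 0) x =
      if μ = 0 then (if p then deriv f (x 0) else 0) else 0 := by
  unfold pdiff
  split_ifs with hp hμ hμ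
  · subst hμ
    simp
  · simp [Function.update_of_ne (Ne.symm hμ)]
  all_goals simp

/-- **Mapping theorem (classical field equations).**
If `φ'' + 2g²φ³ = 0`, then the Smilga configuration `A^a_μ(x) = δ^a_μ φ(x₀)`
with field strength `F^a_{μν} = ∂_μ A^a_ν - ∂_ν A^a_μ + g ε_{abc} A^b_μ A^c_ν`
satisfies the classical SU(2) Yang-Mills equations
`∂^μ F^a_{μν} + g ε_{abc} A^{bμ} F^c_{μν} = 0`. -/
theorem mapping_theorem_yang_mills (g : ℝ) (hg : 0 < g)
    (φ : ℝ → ℝ) (hφ : ContDiff ℝ 2 φ)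
    (hode : ∀ t : ℝ, deriv (deriv φ) t + 2 * g ^ 2 * φ t ^ 3 = 0)
    (A : Fin 3 → Fin 4 → (Fin 4 → ℝ) → ℝ)
    (hA : ∀ (a : Fin 3) (μ : Fin 4) (x : Fin 4 → ℝ),
      A a μ x = if (μ : ℕ) = (a : ℕ) + 1 then φ (x 0) else 0)
    (F : Fin 3 → Fin 4 → Fin 4 → (Fin 4 → ℝ) → ℝ)
    (hF : ∀ (a : Fin 3) (μ ν : Fin 4) (x : Fin 4 → ℝ),
      F a μ ν x = pdiff μ (A a ν) x - pdiff ν (A a μ) x +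
        g * ∑ b : Fin 3, ∑ c : Fin 3, eps a b c * A b μ x * A c ν x) :
    ∀ (a : Fin 3) (ν : Fin 4) (x : Fin 4 → ℝ),
      (∑ μ : Fin 4, η μ * pdiff μ (F a μ ν) x) +
        g * (∑ b : Fin 3, ∑ c : Fin 3, eps a b c *
          ∑ μ : Fin 4, (η μ * A b μ x) * F c μ ν x) = 0 := by
  have hA_time : ∀ a μ, A a μ =
      fun x => if (μ : ℕ) = (a : ℕ) + 1 then φ (x 0) else 0 :=
    fun a μ => funext (hA a μ)
  have deriv_A : ∀ a μ ν x, pdiff μ (A a ν) x =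
      if μ = 0 then (if (ν : ℕ) = (a : ℕ) + 1 then deriv φ (x 0) else 0) else 0 := by
    intro a μ ν x
    rw [hA_time, pdiff_ite_comp_time]
  have hF_time : ∀ a μ ν x, F a μ ν x =
      (if μ = 0 then (if (ν : ℕ) = (a : ℕ) + 1 then deriv φ (x 0) else 0) else 0) -
        (if ν = 0 then (if (μ : ℕ) = (a : ℕ) + 1 then deriv φ (x 0) else 0) else 0) +
        g * ∑ b : Fin 3, ∑ c : Fin 3, eps a b c *
          (if (μ : ℕ) = (b : ℕ) + 1 then φ (x 0) else 0) *
          (if (ν : ℕ) = (c : ℕ) + 1 then φ (x 0) else 0) := by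
    intro a μ ν x
    simp only [hF, deriv_A, hA]
  have spatial_deriv_F : ∀ a μ ν x, μ ≠ 0 → pdiff μ (F a μ ν) x = 0 := by
    intro a μ ν x hμ
    unfold pdiff
    simp only [hF_time, Function.update_of_ne hμ.symm, deriv_const]
  have time_deriv_F : ∀ a ν x, pdiff 0 (F a 0 ν) x =
      if (ν : ℕ) = (a : ℕ) + 1 then deriv (deriv φ) (x 0) else 0 := by
    intro a ν x
    have h : F a 0 ν =
        fun y => if (ν : ℕ) = (a : ℕ) + 1 then deriv φ (y 0) else 0 := by
      funext y
      simp [hF_time]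
    rw [h, pdiff_ite_comp_time, if_pos rfl]
  intro a ν x
  have hode' : deriv (deriv φ) (x 0) = -(2 * g ^ 2 * φ (x 0) ^ 3) := by
    linarith [hode (x 0)]
  have divergence : ∑ μ : Fin 4, η μ * pdiff μ (F a μ ν) x =
      if (ν : ℕ) = (a : ℕ) + 1 then -(2 * g ^ 2 * φ (x 0) ^ 3) else 0 := by
    rw [Fin.sum_univ_succ, time_deriv_F, hode']
    simp [spatial_deriv_F, Fin.succ_ne_zero, η]
  rw [divergence]
  simp only [hA, hF_time]
  fin_cases a <;> fin_cases ν <;>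
    simp [Fin.sum_univ_succ, eps, η, -mul_eq_zero, -mul_eq_mul_left_iff] <;> ring
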